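/- Let N be a rooted binary phylogenetic network on X with k reticulation nodes such that every one of the 2^k ways of deleting one reticulation edge per reticulation node (and suppressing resulting indegree-1 outdegree-1 nodes) yields a phylogenetic X-tree, i.e. |T(N)| = 2^k. Then for every subset S ⊆ X, the phylogenetic net diversity equals the minimum embedded phylogenetic diversity: PND(S) = min over T in T(N) of PD_T(S). -/

import Mathlib

open Finset
open scoped Classical

/-- `IsPath E u v p` : `p` is a list of consecutive edges of `E` leading from `u` to `v`. -/
def IsPath {V : Type*} (E : Finset (V × V)) : V → V → List (V × V) → Prop
  | u, v, [] => u = v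
  | u, v, e :: p => e ∈ E ∧ e.1 = u ∧ IsPath E e.2 v p

/-- The vertex `u` lies on the path `p` starting at the vertex `a`. -/
def MemPath {V : Type*} (u a : V) (p : List (V × V)) : Prop :=
  u = a ∨ ∃ e ∈ p, e.2 = u

/-- indegree of a vertex. -/
def inDeg {V : Type*} [DecidableEq V] (E : Finset (V × V)) (v : V) : ℕ :=
  (E.filter fun e => e.2 = v).card

/-- outdegree of a vertex. -/
def outDeg {V : Type*} [DecidableEq V] (E : Finset (V × V)) (v : V) : ℕ :=
  (E.filter fun e => e.1 = v).card

/-- All lists of length `n` with entries in `s`. -/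
def listsOf {V : Type*} [DecidableEq V] (s : Finset (V × V)) : ℕ → Finset (List (V × V))
  | 0 => {[]}
  | n + 1 => s.biUnion fun e => (listsOf s n).image (e :: ·)

/-- The (finite) set of all directed paths from `u` to `v` in an acyclic digraph. -/
noncomputable def allPaths {V : Type*} [Fintype V] [DecidableEq V]
    (E : Finset (V × V)) (u v : V) : Finset (List (V × V)) :=
  ((Finset.range (Fintype.card V + 1)).biUnion (listsOf E)).filter (IsPath E u v)

/-- A rooted binary phylogenetic network on the taxon set `X`, with vertex set `V`,
edge lengths and inheritance probabilities. -/
structure PhyloNetwork (V X : Type*) [Fintype V] [DecidableEq V] [Fintype X] where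
  E : Finset (V × V)
  root : V
  len : V × V → ℝ
  prob : V × V → ℝ
  leafOf : X → V
  leafOf_inj : Function.Injective leafOf
  root_in : inDeg E root = 0
  root_out : outDeg E root = 2
  leaf_iff : ∀ v, outDeg E v = 0 ↔ ∃ x, leafOf x = v
  leaf_in : ∀ x, inDeg E (leafOf x) = 1
  internal : ∀ v, v ≠ root → outDeg E v ≠ 0 →
      (inDeg E v = 1 ∧ outDeg E v = 2) ∨ (inDeg E v = 2 ∧ outDeg E v = 1)
  reach : ∀ v, ∃ p, IsPath E root v p
  acyclic : ∀ (v : V) (p : List (V × V)), p ≠ [] → ¬ IsPath E v v p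
  len_nonneg : ∀ e ∈ E, 0 ≤ len e
  len_pos_tree : ∀ e ∈ E, inDeg E e.2 ≤ 1 → 0 < len e
  len_retic : ∀ e ∈ E, inDeg E e.2 = 2 → len e = 0
  prob_tree : ∀ e ∈ E, inDeg E e.2 ≤ 1 → prob e = 1
  prob_pos : ∀ e ∈ E, 0 < prob e
  prob_lt_one : ∀ e ∈ E, inDeg E e.2 = 2 → prob e < 1
  prob_sum : ∀ v, inDeg E v = 2 → ∑ e ∈ E.filter (fun e => e.2 = v), prob e = 1

namespace PhyloNetwork

variable {V X : Type*} [Fintype V] [DecidableEq V] [Fintype X] [DecidableEq X]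
variable (N : PhyloNetwork V X)

/-- Probability of a directed path: the product of the probabilities of its edges. -/
noncomputable def pathProb (p : List (V × V)) : ℝ := (p.map N.prob).prod

/-- Total weight (sum of branch lengths) of a set of edges. -/
noncomputable def weight (A : Finset (V × V)) : ℝ := ∑ e ∈ A, N.len e

/-- A switching keeps exactly one incoming edge of every non-root vertex, i.e. it
deletes exactly one of the two incoming reticulation edges of each reticulation node
and keeps all tree edges. -/
def IsSwitching (F : Finset (V × V)) : Prop :=
  F ⊆ N.E ∧ ∀ v, v ≠ N.root → (F.filter fun e => e.2 = v).card = 1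

/-- The switching yields a phylogenetic `X`-tree: every dead end is a labeled leaf. -/
def IsValidSwitching (F : Finset (V × V)) : Prop :=
  N.IsSwitching F ∧ ∀ v, outDeg F v = 0 → ∃ x, N.leafOf x = v

/-- The (multi)set `T(N)` of phylogenetic `X`-trees displayed by `N`, each tree being
encoded by the switching producing it. -/
noncomputable def displayed : Finset (Finset (V × V)) :=
  N.E.powerset.filter N.IsValidSwitching

/-- The set of leaves lying below the edge `e` inside the subgraph `F`. -/
noncomputable def clusterIn (F : Finset (V × V)) (e : V × V) : Finset X :=
  Finset.univ.filter fun x => ∃ p, IsPath F e.2 (N.leafOf x) p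

/-- Phylogenetic diversity of `S` in the tree displayed by the switching `F`
(the sum of the lengths of the edges of the minimal subtree spanning `S` and the root;
suppression of degree-two vertices merges edge lengths additively, so it is computed
on the unsuppressed switching). -/
noncomputable def PDdisp (F : Finset (V × V)) (S : Finset X) : ℝ :=
  ∑ e ∈ F.filter (fun e => (N.clusterIn F e ∩ S).Nonempty), N.len e

/-- Unscaled probability of the tree displayed by the switching `F`: the product of the
inheritance probabilities of the kept reticulation edges. -/
noncomputable def Punsc (F : Finset (V × V)) : ℝ :=
  ∏ e ∈ F.filter (fun e => inDeg N.E e.2 = 2), N.prob e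

/-- `v` is a vertex of the edge set `A`. -/
def vertexOf (A : Finset (V × V)) (v : V) : Prop := ∃ e ∈ A, e.1 = v ∨ e.2 = v

/-- `A` is an arborescence rooted at the root of `N` inside `N`: there is exactly one
directed path from the root to each of its vertices. -/
def IsArbor (A : Finset (V × V)) : Prop :=
  A ⊆ N.E ∧ ∀ v, vertexOf A v → (allPaths A N.root v).card = 1

/-- `A` contains all taxa of `S`. -/
def spans (A : Finset (V × V)) (S : Finset X) : Prop :=
  ∀ x ∈ S, vertexOf A (N.leafOf x)

/-- Phylogenetic net diversity: the weight of a minimum cost arborescence containing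
`S` and the root. -/
noncomputable def PND (S : Finset X) : ℝ :=
  sInf {w : ℝ | ∃ A, N.IsArbor A ∧ N.spans A S ∧ w = N.weight A}

/-- Phylogenetic subnet diversity: the total weight of the subgraph of `N` consisting of
all edges lying on some directed path from the root to a leaf of `S`. -/
noncomputable def PSD (S : Finset X) : ℝ :=
  ∑ e ∈ N.E.filter (fun e => ∃ x ∈ S, ∃ p, IsPath N.E N.root (N.leafOf x) p ∧ e ∈ p), N.len e

/-- Probability that the leaf `d` is a descendant of the node `v`: the sum of the
probabilities of all directed paths from `v` to `d`. -/
noncomputable def Pdesc (v : V) (d : X) : ℝ :=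
  ∑ p ∈ allPaths N.E v (N.leafOf d), N.pathProb p

/-- The set of leaves that are descendants of the edge `e`. -/
noncomputable def De (e : V × V) : Finset X :=
  Finset.univ.filter fun x => ∃ p, IsPath N.E e.2 (N.leafOf x) p

/-- Net Fair Proportion Index of the taxon `a`. -/
noncomputable def NFP (a : X) : ℝ :=
  ∑ p ∈ allPaths N.E N.root (N.leafOf a),
    N.pathProb p * (p.map (fun e => N.len e / ∑ d ∈ N.De e, N.Pdesc e.2 d)).sum

end PhyloNetwork

/-- The original Shapley Value of a set function `f` (with `f ∅ = 0`). -/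
noncomputable def shapley {X : Type*} [Fintype X] [DecidableEq X]
    (f : Finset X → ℝ) (a : X) : ℝ :=
  (1 / (Nat.factorial (Fintype.card X) : ℝ)) *
    ∑ S ∈ Finset.univ.powerset.filter (fun S : Finset X => a ∈ S),
      ((S.card - 1).factorial : ℝ) * ((Fintype.card X - S.card).factorial : ℝ) *
        (f S - f (S.erase a))


section Helpers

theorem isPath_append {V : Type*} (E : Finset (V × V)) (w : V) (q : List (V × V)) :
    ∀ (p : List (V × V)) (u : V), IsPath E u w (p ++ q) ↔ ∃ v, IsPath E u v p ∧ IsPath E v w q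
  | [], u => by simp [IsPath]
  | e :: p, u => by
      simp only [List.cons_append, IsPath, isPath_append E w q p]
      constructor
      · rintro ⟨h1, h2, v, h3, h4⟩; exact ⟨v, ⟨h1, h2, h3⟩, h4⟩
      · rintro ⟨v, ⟨h1, h2, h3⟩, h4⟩; exact ⟨h1, h2, v, h3, h4⟩

theorem isPath_snoc {V : Type*} (E : Finset (V × V)) (u w : V) (p : List (V × V)) (e : V × V) :
    IsPath E u w (p ++ [e]) ↔ IsPath E u e.1 p ∧ e ∈ E ∧ e.2 = w := by
  rw [isPath_append]
  simp only [IsPath]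
  constructor
  · rintro ⟨v, h1, h2, rfl, h4⟩; exact ⟨h1, h2, h4⟩
  · rintro ⟨h1, h2, h3⟩; exact ⟨_, h1, h2, rfl, h3⟩

theorem isPath_mono {V : Type*} {E F : Finset (V × V)} {v : V} :
    ∀ {p : List (V × V)} {u : V}, (∀ e ∈ p, e ∈ F) → IsPath E u v p → IsPath F u v p
  | [], u => fun _ h => h
  | e :: p, u => fun hs h =>
      ⟨hs e (by simp), h.2.1, isPath_mono (fun e' he' => hs e' (by simp [he'])) h.2.2⟩

theorem isPath_mem {V : Type*} {E : Finset (V × V)} {v : V} :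
    ∀ {p : List (V × V)} {u : V}, IsPath E u v p → ∀ e ∈ p, e ∈ E
  | [], u => by simp
  | e :: p, u => by
      rintro ⟨h1, h2, h3⟩ e' he'
      rcases List.mem_cons.1 he' with rfl | h
      · exact h1
      · exact isPath_mem h3 e' h

theorem isPath_nodup {V : Type*} {E : Finset (V × V)}
    (hac : ∀ (v : V) (p : List (V × V)), p ≠ [] → ¬ IsPath E v v p) {v : V} :
    ∀ {p : List (V × V)} {u : V}, IsPath E u v p → (p.map Prod.snd).Nodup
  | [], u => by simp
  | e :: p, u => by
      rintro ⟨h1, h2, h3⟩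
      rw [List.map_cons, List.nodup_cons]
      refine ⟨?_, isPath_nodup hac h3⟩
      intro hm
      obtain ⟨e', he', hee⟩ := List.mem_map.1 hm
      obtain ⟨a, b, rfl⟩ := List.append_of_mem he'
      have : a ++ e' :: b = (a ++ [e']) ++ b := by simp
      rw [this, isPath_append] at h3
      obtain ⟨w, hw, -⟩ := h3
      have h5 := (isPath_snoc _ _ _ _ _).1 hw
      have : w = e.2 := by rw [← h5.2.2, hee]
      subst this
      exact hac _ _ (by simp) hw

theorem mem_listsOf_iff {V : Type*} [DecidableEq V] (s : Finset (V × V)) :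
    ∀ (n : ℕ) (l : List (V × V)), l ∈ listsOf s n ↔ l.length = n ∧ ∀ e ∈ l, e ∈ s
  | 0, l => by
      simp only [listsOf, Finset.mem_singleton]
      constructor
      · rintro rfl; simp
      · rintro ⟨h, -⟩; exact List.length_eq_zero_iff.1 h
  | n + 1, l => by
      simp only [listsOf, Finset.mem_biUnion, Finset.mem_image, mem_listsOf_iff s n]
      constructor
      · rintro ⟨e, he, l', ⟨h1, h2⟩, rfl⟩
        refine ⟨by simp [h1], ?_⟩
        intro e' he'
        rcases List.mem_cons.1 he' with rfl | h
        · exact he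
        · exact h2 _ h
      · rintro ⟨h1, h2⟩
        cases l with
        | nil => simp at h1
        | cons e l =>
          exact ⟨e, h2 e (by simp), l, ⟨by simpa using h1, fun e' he' => h2 e' (by simp [he'])⟩, rfl⟩

theorem mem_allPaths_iff {V : Type*} [Fintype V] [DecidableEq V] {E : Finset (V × V)}
    (hac : ∀ (v : V) (p : List (V × V)), p ≠ [] → ¬ IsPath E v v p) (u v : V)
    (p : List (V × V)) : p ∈ allPaths E u v ↔ IsPath E u v p := by
  simp only [allPaths, Finset.mem_filter, Finset.mem_biUnion, Finset.mem_range, mem_listsOf_iff]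
  constructor
  · exact fun h => h.2
  · intro h
    refine ⟨⟨p.length, ?_, rfl, isPath_mem h⟩, h⟩
    have := (isPath_nodup hac h).length_le_card
    rw [List.length_map] at this
    omega

theorem isPath_unique {V : Type*} {F : Finset (V × V)} {r : V}
    (hr : ∀ e ∈ F, e.2 ≠ r) (hu : ∀ e ∈ F, ∀ e' ∈ F, e.2 = e'.2 → e = e') :
    ∀ (p q : List (V × V)) (v : V), IsPath F r v p → IsPath F r v q → p = q := by
  intro p
  induction p using List.reverseRecOn with
  | nil =>
    intro q v hp hq
    cases q using List.reverseRecOn with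
    | nil => rfl
    | append_singleton q e =>
      have h := (isPath_snoc _ _ _ _ _).1 hq
      have hp' : r = v := hp
      exact absurd (h.2.2.trans hp'.symm) (hr e h.2.1)
  | append_singleton p e ih =>
    intro q v hp hq
    have h := (isPath_snoc _ _ _ _ _).1 hp
    cases q using List.reverseRecOn with
    | nil =>
      have hq' : r = v := hq
      exact absurd (h.2.2.trans hq'.symm) (hr e h.2.1)
    | append_singleton q e' =>
      have h' := (isPath_snoc _ _ _ _ _).1 hq
      have : e = e' := hu _ h.2.1 _ h'.2.1 (h.2.2.trans h'.2.2.symm)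
      subst this
      rw [ih q _ h.1 h'.1]

theorem transGen_path {V : Type*} {E : Finset (V × V)} {u v : V}
    (h : Relation.TransGen (fun a b => (a, b) ∈ E) u v) : ∃ p, p ≠ [] ∧ IsPath E u v p := by
  induction h with
  | single h => exact ⟨[(u, _)], by simp, h, rfl, rfl⟩
  | tail _ h ih =>
    obtain ⟨p, -, hp⟩ := ih
    exact ⟨p ++ [(_, _)], by simp, (isPath_snoc _ _ _ _ _).2 ⟨hp, h, rfl⟩⟩

namespace PhyloNetwork

variable {V X : Type*} [Fintype V] [DecidableEq V] [Fintype X] [DecidableEq X]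
variable (N : PhyloNetwork V X)

theorem acyclic_sub {A : Finset (V × V)} (hA : A ⊆ N.E) :
    ∀ (v : V) (p : List (V × V)), p ≠ [] → ¬ IsPath A v v p := fun v p hp h =>
  N.acyclic v p hp (isPath_mono (fun e he => hA (isPath_mem h e he)) h)

theorem not_into_root : ∀ e ∈ N.E, e.2 ≠ N.root := by
  intro e he h
  have h0 := N.root_in
  rw [inDeg, Finset.card_eq_zero] at h0
  have : e ∈ N.E.filter fun e => e.2 = N.root := by simp [he, h]
  rw [h0] at this
  simp at this

theorem leaf_ne_root (x : X) : N.leafOf x ≠ N.root := by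
  intro h
  have h1 := (N.leaf_iff N.root).2 ⟨x, h⟩
  have h2 := N.root_out
  omega

theorem switching_unique {F : Finset (V × V)} (hF : N.IsSwitching F) :
    ∀ e ∈ F, ∀ e' ∈ F, e.2 = e'.2 → e = e' := by
  intro e he e' he' h
  have h1 := hF.2 e.2 (N.not_into_root e (hF.1 he))
  exact Finset.card_le_one.1 h1.le e (by simp [he]) e' (by simp [he', h])

theorem switching_exists {F : Finset (V × V)} (hF : N.IsSwitching F) (v : V) (hv : v ≠ N.root) :
    ∃ e ∈ F, e.2 = v := by
  have h1 := hF.2 v hv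
  obtain ⟨e, he⟩ := Finset.card_pos.1 (by rw [h1]; exact one_pos)
  exact ⟨e, by simpa using he⟩

theorem switching_reach {F : Finset (V × V)} (hF : N.IsSwitching F) (v : V) :
    ∃ p, IsPath F N.root v p := by
  let R : V → V → Prop := Relation.TransGen (fun a b => (a, b) ∈ N.E)
  have hirr : Std.Irrefl R := ⟨fun a h => by
    obtain ⟨p, hp, h'⟩ := transGen_path h
    exact N.acyclic a p hp h'⟩
  have htr : IsTrans V R := ⟨fun a b c => Relation.TransGen.trans⟩
  have hwf : WellFounded R := Finite.wellFounded_of_trans_of_irrefl R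
  induction v using hwf.induction with
  | _ v ih =>
    by_cases hv : v = N.root
    · exact ⟨[], hv.symm⟩
    · obtain ⟨e, he, h⟩ := N.switching_exists hF v hv
      obtain ⟨p, hp⟩ := ih e.1 (Relation.TransGen.single (by rw [← h]; exact hF.1 he))
      exact ⟨p ++ [e], (isPath_snoc _ _ _ _ _).2 ⟨hp, he, h⟩⟩

theorem arbor_of_switching {F : Finset (V × V)} (hF : N.IsSwitching F) (S : Finset X) :
    ∃ A, N.IsArbor A ∧ N.spans A S ∧ N.PDdisp F S = N.weight A := by
  refine ⟨F.filter (fun e => (N.clusterIn F e ∩ S).Nonempty), ?_, ?_, rfl⟩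
  · have hAF := Finset.filter_subset (fun e => (N.clusterIn F e ∩ S).Nonempty) F
    have hAE := hAF.trans hF.1
    refine ⟨hAE, ?_⟩
    -- paths to sources of edges of A
    have key : ∀ e ∈ F.filter (fun e => (N.clusterIn F e ∩ S).Nonempty),
        ∃ p, IsPath (F.filter (fun e => (N.clusterIn F e ∩ S).Nonempty)) N.root e.1 p := by
      intro e he
      obtain ⟨heF, x, hx⟩ := Finset.mem_filter.1 he
      obtain ⟨hx1, hxS⟩ := Finset.mem_inter.1 hx
      obtain ⟨q, hq⟩ := (Finset.mem_filter.1 hx1).2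
      obtain ⟨p, hp⟩ := N.switching_reach hF e.1
      refine ⟨p, isPath_mono ?_ hp⟩
      intro e' he'
      refine Finset.mem_filter.2 ⟨isPath_mem hp e' he', x, Finset.mem_inter.2 ⟨?_, hxS⟩⟩
      refine Finset.mem_filter.2 ⟨Finset.mem_univ _, ?_⟩
      obtain ⟨a, b, rfl⟩ := List.append_of_mem he'
      obtain ⟨w, -, hw⟩ := (isPath_append _ _ _ _ _).1 hp
      exact ⟨b ++ (e :: q), (isPath_append _ _ _ _ _).2 ⟨_, hw.2.2, heF, rfl, hq⟩⟩
    rintro v ⟨e, he, hv⟩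
    have hex : ∃ p, IsPath (F.filter (fun e => (N.clusterIn F e ∩ S).Nonempty)) N.root v p := by
      obtain ⟨p, hp⟩ := key e he
      rcases hv with rfl | rfl
      · exact ⟨p, hp⟩
      · exact ⟨p ++ [e], (isPath_snoc _ _ _ _ _).2 ⟨hp, he, rfl⟩⟩
    obtain ⟨p, hp⟩ := hex
    refine Finset.card_eq_one.2 ⟨p, ?_⟩
    ext q
    rw [mem_allPaths_iff (N.acyclic_sub hAE), Finset.mem_singleton]
    constructor
    · intro hq
      exact isPath_unique (fun e he => N.not_into_root e (hAE he))
        (fun e he e' he' => N.switching_unique hF e (hAF he) e' (hAF he')) _ _ _ hq hp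
    · rintro rfl; exact hp
  · intro x hx
    obtain ⟨e, he, h⟩ := N.switching_exists hF _ (N.leaf_ne_root x)
    refine ⟨e, Finset.mem_filter.2 ⟨he, x, Finset.mem_inter.2 ⟨?_, hx⟩⟩, Or.inr h⟩
    exact Finset.mem_filter.2 ⟨Finset.mem_univ _, [], h⟩

theorem exists_switching {A : Finset (V × V)} (hA : N.IsArbor A) :
    ∃ F, N.IsSwitching F ∧ A ⊆ F := by
  have hpath : ∀ v, vertexOf A v → ∃ p, IsPath A N.root v p ∧ ∀ q, IsPath A N.root v q → q = p := by
    intro v hv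
    obtain ⟨p, hp⟩ := Finset.card_eq_one.1 (hA.2 v hv)
    have h := fun q => mem_allPaths_iff (N.acyclic_sub hA.1) N.root v q
    simp only [hp, Finset.mem_singleton] at h
    exact ⟨p, (h p).1 rfl, fun q hq => (h q).2 hq⟩
  have huniq : ∀ e ∈ A, ∀ e' ∈ A, e.2 = e'.2 → e = e' := by
    intro e he e' he' h
    obtain ⟨p, hp, -⟩ := hpath e.1 ⟨e, he, Or.inl rfl⟩
    obtain ⟨p', hp', -⟩ := hpath e'.1 ⟨e', he', Or.inl rfl⟩
    obtain ⟨q, -, hq⟩ := hpath e.2 ⟨e, he, Or.inr rfl⟩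
    have h1 := hq _ ((isPath_snoc _ _ _ _ _).2 ⟨hp, he, rfl⟩)
    have h2 := hq _ ((isPath_snoc _ _ _ _ _).2 ⟨hp', he', h.symm⟩)
    have h3 := List.append_inj' (h1.trans h2.symm) rfl
    simpa using h3.2
  have hin : ∀ v, v ≠ N.root → ∃ e ∈ N.E, e.2 = v := by
    intro v hv
    obtain ⟨p, hp⟩ := N.reach v
    cases p using List.reverseRecOn with
    | nil => exact absurd (show N.root = v from hp).symm hv
    | append_singleton p e => exact ⟨e, ((isPath_snoc _ _ _ _ _).1 hp).2⟩
  have hch : ∀ v, ∃ e : V × V, v ≠ N.root → e ∈ N.E ∧ e.2 = v ∧ ∀ e' ∈ A, e'.2 = v → e' = e := by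
    intro v
    by_cases h : ∃ e ∈ A, e.2 = v
    · obtain ⟨e, he, rfl⟩ := h
      exact ⟨e, fun _ => ⟨hA.1 he, rfl, fun e' he' h => huniq _ he' _ he h⟩⟩
    · by_cases hv : v = N.root
      · exact ⟨(v, v), fun h => absurd hv h⟩
      · obtain ⟨e, he, h'⟩ := hin v hv
        exact ⟨e, fun _ => ⟨he, h', fun e' he' h'' => absurd ⟨e', he', h''⟩ h⟩⟩
  choose f hf using hch
  refine ⟨(Finset.univ.filter (fun v => v ≠ N.root)).image f, ⟨?_, ?_⟩, ?_⟩
  · intro e he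
    obtain ⟨v, hv, rfl⟩ := Finset.mem_image.1 he
    exact (hf v (Finset.mem_filter.1 hv).2).1
  · intro v hv
    refine Finset.card_eq_one.2 ⟨f v, ?_⟩
    ext e
    simp only [Finset.mem_filter, Finset.mem_image, Finset.mem_univ, true_and,
      Finset.mem_singleton]
    constructor
    · rintro ⟨⟨w, hw, rfl⟩, h⟩
      rw [(hf w hw).2.1] at h
      rw [h]
    · rintro rfl
      exact ⟨⟨v, hv, rfl⟩, (hf v hv).2.1⟩
  · intro e he
    have hne := N.not_into_root e (hA.1 he)
    exact Finset.mem_image.2 ⟨e.2, by simp [hne], ((hf e.2 hne).2.2 e he rfl).symm⟩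

theorem PDdisp_le {A F : Finset (V × V)} (hA : N.IsArbor A) (hF : N.IsSwitching F) (hAF : A ⊆ F)
    {S : Finset X} (hS : N.spans A S) : N.PDdisp F S ≤ N.weight A := by
  refine Finset.sum_le_sum_of_subset_of_nonneg ?_ (fun e he _ => N.len_nonneg e (hA.1 he))
  intro e he
  obtain ⟨heF, x, hx⟩ := Finset.mem_filter.1 he
  obtain ⟨hx1, hxS⟩ := Finset.mem_inter.1 hx
  obtain ⟨q, hq⟩ := (Finset.mem_filter.1 hx1).2
  obtain ⟨r, hr⟩ := N.switching_reach hF e.1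
  obtain ⟨p, hp⟩ := Finset.card_eq_one.1 (hA.2 _ (hS x hxS))
  have hp' : IsPath A N.root (N.leafOf x) p :=
    (mem_allPaths_iff (N.acyclic_sub hA.1) _ _ _).1 (by rw [hp]; simp)
  have h1 : IsPath F N.root (N.leafOf x) (r ++ e :: q) :=
    (isPath_append _ _ _ _ _).2 ⟨_, hr, heF, rfl, hq⟩
  have h2 := isPath_unique (fun e he => N.not_into_root e (hF.1 he)) (N.switching_unique hF) _ _ _
    h1 (isPath_mono (fun e he => hAF (isPath_mem hp' e he)) hp')
  exact isPath_mem hp' e (by rw [← h2]; simp)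

end PhyloNetwork

end Helpers

/-- if every one of the `2 ^ k` ways of deleting one reticulation edge per
reticulation node yields a phylogenetic `X`-tree (i.e. every switching is valid, so that
`|T(N)| = 2 ^ k`), then the phylogenetic net diversity equals the minimum embedded
phylogenetic diversity for every subset `S` of taxa. -/
theorem PND_eq_min_embedded_PD {V X : Type*} [Fintype V] [DecidableEq V] [Fintype X] [DecidableEq X] (N : PhyloNetwork V X)
    (hall : ∀ F, N.IsSwitching F → N.IsValidSwitching F)
    (hne : N.displayed.Nonempty) (S : Finset X) :
    N.PND S = N.displayed.inf' hne (fun F => N.PDdisp F S) := by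
  have hw : ∀ w ∈ {w : ℝ | ∃ A, N.IsArbor A ∧ N.spans A S ∧ w = N.weight A},
      N.displayed.inf' hne (fun F => N.PDdisp F S) ≤ w := by
    rintro w ⟨A, hA, hS, rfl⟩
    obtain ⟨F, hF, hAF⟩ := N.exists_switching hA
    refine (Finset.inf'_le _ ?_).trans (N.PDdisp_le hA hF hAF hS)
    exact Finset.mem_filter.2 ⟨Finset.mem_powerset.2 hF.1, hall F hF⟩
  apply le_antisymm
  · refine Finset.le_inf' _ _ ?_
    intro F hF
    exact csInf_le ⟨_, hw⟩ (N.arbor_of_switching (Finset.mem_filter.1 hF).2.1 S)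
  · obtain ⟨F, hF⟩ := hne
    exact le_csInf ⟨_, N.arbor_of_switching (Finset.mem_filter.1 hF).2.1 S⟩ hw
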